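/- arXiv:2211.07691 — 2 statements merged into one kernel-verified Lean document; each statement's English description precedes it below -/
import Mathlib

section
/- Let Q = Q_1⋯Q_t be a homogeneous polynomial in F[x_1,…,x_n] of degree d = d_1 + ⋯ + d_t ≥ 1, where each Q_i is homogeneous of degree d_i ≥ 1. Then for any integers 0 ≤ k < d and 1 ≤ n_0 ≤ n: APP_{k,n_0}(Q) ≤ 2^t · d^2 · max{ M(n,k_0)·M(n_0,ℓ_0) : k_0, ℓ_0 ≥ 0 integers with k_0 + (k/(d−k))·ℓ_0 ≤ k − residue_k(d_1,…,d_t) }. -/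
open MvPolynomial

/-- The iterated partial derivative operator `∂_m` associated to the exponent vector `m`. -/
noncomputable def iterDeriv {σv F : Type*} [CommRing F] (m : σv →₀ ℕ) :
    Module.End F (MvPolynomial σv F) :=
  (m.support.toList.map
    (fun i => ((MvPolynomial.pderiv i).toLinearMap : Module.End F (MvPolynomial σv F)) ^ m i)).prod

/-- `∂^k P` : the set of all partial derivatives of `P` of order `k`. -/
noncomputable def partialsSet {σv F : Type*} [CommRing F] (k : ℕ) (P : MvPolynomial σv F) :
    Set (MvPolynomial σv F) :=
  { g | ∃ m : σv →₀ ℕ, (m.sum fun _ e => e) = k ∧ g = iterDeriv m P }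

/-- `x^ℓ · ∂^k P` : degree-`ℓ` monomial multiples of order-`k` partial derivatives of `P`. -/
noncomputable def shiftedPartialsSet {σv F : Type*} [CommRing F] (ℓ k : ℕ)
    (P : MvPolynomial σv F) : Set (MvPolynomial σv F) :=
  { q | ∃ m : σv →₀ ℕ, (m.sum fun _ e => e) = ℓ ∧
      ∃ g ∈ partialsSet k P, q = MvPolynomial.monomial m (1 : F) * g }

/-- The shifted partials measure `SP_{k,ℓ}`. -/
noncomputable def SP {σv F : Type*} [Field F] (k ℓ : ℕ) (P : MvPolynomial σv F) : ℕ :=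
  Module.finrank F (Submodule.span F (shiftedPartialsSet ℓ k P))

/-- The affine projections of partials measure `APP_{k,n₀}`. -/
noncomputable def APP {σv F : Type*} [Field F] (k n0 : ℕ) (P : MvPolynomial σv F) : ℕ :=
  sSup { r : ℕ | ∃ L : σv → MvPolynomial (Fin n0) F, (∀ i, (L i).IsHomogeneous 1) ∧
    r = Module.finrank F (Submodule.span F
          ((fun g => MvPolynomial.aeval L g) '' partialsSet k P)) }

/-- `residue_k(d_1,…,d_t)`. -/
noncomputable def residue {t : ℕ} (k : ℕ) (ds : Fin t → ℕ) : ℝ :=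
  (1 / 2) * sInf { r : ℝ | ∃ κ : Fin t → ℤ,
    r = ∑ i, |(κ i : ℝ) - ((k : ℝ) / ((∑ i, ds i : ℕ) : ℝ)) * (ds i : ℝ)| }

/-- `M(a,b) = C(a+b−1, b)`, the number of monic monomials of degree `b` in `a` variables. -/
def M (a b : ℕ) : ℕ := Nat.choose (a + b - 1) b

section TaylorExpansion

variable {σ F : Type*} [CommRing F]

/-- The Taylor expansion `P ↦ P(x + y)`, as a polynomial in `y` with coefficients in `F[x]`. -/
noncomputable def taylorHom : MvPolynomial σ F →ₐ[F] MvPolynomial σ (MvPolynomial σ F) :=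
  aeval fun i => C (X i) + X i

/-- The Hasse derivative: the coefficient of `y ^ m` in `P(x + y)`. -/
noncomputable def hasse (m : σ →₀ ℕ) (P : MvPolynomial σ F) : MvPolynomial σ F :=
  coeff m (taylorHom P)

lemma taylorHom_pderiv (i : σ) (P : MvPolynomial σ F) :
    taylorHom (pderiv i P) = pderiv i (taylorHom P) := by
  classical
  induction P using MvPolynomial.induction_on with
  | C a =>
    rw [pderiv_C, map_zero, ← algebraMap_eq, AlgHom.commutes,
      IsScalarTower.algebraMap_apply F (MvPolynomial σ F), algebraMap_eq, algebraMap_eq, pderiv_C]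
  | add p q hp hq => simp only [map_add, hp, hq]
  | mul_X p j hp =>
    have hX : taylorHom (pderiv i (X j : MvPolynomial σ F)) =
        pderiv i (taylorHom (X j : MvPolynomial σ F)) := by
      by_cases h : j = i
      · subst h; simp [taylorHom]
      · simp [taylorHom, pderiv_X_of_ne h]
    rw [pderiv_mul, map_add, map_mul, map_mul, map_mul, pderiv_mul, hp, hX]

lemma hasse_zero (P : MvPolynomial σ F) : hasse 0 P = P := by
  have h : ((constantCoeff : MvPolynomial σ (MvPolynomial σ F) →+* _).comp
      (taylorHom : MvPolynomial σ F →ₐ[F] _).toRingHom) = RingHom.id _ := by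
    apply MvPolynomial.ringHom_ext
    · intro a
      simp [taylorHom, IsScalarTower.algebraMap_apply F (MvPolynomial σ F)
        (MvPolynomial σ (MvPolynomial σ F))]
    · intro i
      simp [taylorHom]
  exact congrArg (fun f => f P) h

lemma hasse_pderiv (m : σ →₀ ℕ) (i : σ) (P : MvPolynomial σ F) :
    hasse m (pderiv i P) = ((m i + 1 : ℕ) : F) • hasse (m + Finsupp.single i 1) P := by
  rw [hasse, taylorHom_pderiv, coeff_pderiv, hasse, Nat.cast_smul_eq_nsmul, nsmul_eq_mul, mul_comm]
  push_cast
  rfl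

lemma exists_hasse_pderiv_pow (i : σ) (e : ℕ) (m : σ →₀ ℕ) (P : MvPolynomial σ F) :
    ∃ c : F, hasse m (((pderiv i).toLinearMap ^ e : Module.End F (MvPolynomial σ F)) P) =
      c • hasse (m + Finsupp.single i e) P := by
  induction e generalizing m with
  | zero => exact ⟨1, by simp⟩
  | succ e ih =>
    obtain ⟨c, hc⟩ := ih (m + Finsupp.single i 1)
    refine ⟨((m i + 1 : ℕ) : F) * c, ?_⟩
    rw [pow_succ', Module.End.mul_apply]
    refine (hasse_pderiv m i _).trans ?_
    rw [hc, smul_smul, add_assoc, ← Finsupp.single_add, add_comm 1 e]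

lemma exists_iterDeriv_eq_smul_hasse (m : σ →₀ ℕ) (P : MvPolynomial σ F) :
    ∃ c : F, iterDeriv m P = c • hasse m P := by
  have key (l : List σ) (a : σ →₀ ℕ) : ∃ c : F, hasse a ((l.map fun i =>
      ((pderiv i).toLinearMap ^ m i : Module.End F (MvPolynomial σ F))).prod P) =
        c • hasse (a + (l.map fun i => Finsupp.single i (m i)).sum) P := by
    induction l generalizing a with
    | nil => exact ⟨1, by simp⟩
    | cons i l ih =>
      rw [List.map_cons, List.prod_cons, Module.End.mul_apply, List.map_cons, List.sum_cons]
      obtain ⟨c, hc⟩ := exists_hasse_pderiv_pow i (m i) a ((l.map fun i =>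
        ((pderiv i).toLinearMap ^ m i : Module.End F (MvPolynomial σ F))).prod P)
      obtain ⟨c', hc'⟩ := ih (a + Finsupp.single i (m i))
      exact ⟨c * c', by rw [hc, hc', smul_smul, add_assoc]⟩
  obtain ⟨c, hc⟩ := key m.support.toList 0
  refine ⟨c, ?_⟩
  rw [hasse_zero, zero_add, Finset.sum_map_toList] at hc
  rw [iterDeriv, hc]
  congr 2
  exact Finsupp.sum_single m

/-- A polynomial in `y` over `F[x]` that is jointly homogeneous of degree `d` in `x` and `y`. -/
def IsJointlyHomogeneous (G : MvPolynomial σ (MvPolynomial σ F)) (d : ℕ) : Prop :=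
  ∀ a : σ →₀ ℕ, (∀ e, a.degree + e = d → (coeff a G).IsHomogeneous e) ∧
    (d < a.degree → coeff a G = 0)

namespace IsJointlyHomogeneous

variable {G H : MvPolynomial σ (MvPolynomial σ F)} {p q : ℕ}

lemma algebraMap (c : F) :
    IsJointlyHomogeneous (algebraMap F (MvPolynomial σ (MvPolynomial σ F)) c) 0 := by
  classical
  intro a
  rw [IsScalarTower.algebraMap_apply F (MvPolynomial σ F), algebraMap_eq, algebraMap_eq, coeff_C]
  refine ⟨fun e he => ?_, fun ha => if_neg ?_⟩
  · obtain rfl : e = 0 := by omega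
    split_ifs
    · exact isHomogeneous_C _ _
    · exact isHomogeneous_zero _ _ _
  · rintro rfl
    simp at ha

lemma C_X_add_X (i : σ) :
    IsJointlyHomogeneous (C (X i) + X i : MvPolynomial σ (MvPolynomial σ F)) 1 := by
  classical
  intro a
  rw [coeff_add, coeff_C, coeff_X]
  refine ⟨fun e he => ?_, fun ha => ?_⟩
  · refine IsHomogeneous.add ?_ ?_ <;> split_ifs with h
    · subst h
      obtain rfl : e = 1 := by simpa using he
      exact isHomogeneous_X _ _
    · exact isHomogeneous_zero _ _ _
    · subst h
      obtain rfl : e = 0 := by simpa using he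
      exact isHomogeneous_one _ _
    · exact isHomogeneous_zero _ _ _
  · rw [if_neg, if_neg, add_zero]
    · rintro rfl
      simp at ha
    · rintro rfl
      simp at ha

lemma sum {ι : Type*} (s : Finset ι) {G : ι → MvPolynomial σ (MvPolynomial σ F)}
    (h : ∀ i ∈ s, IsJointlyHomogeneous (G i) p) : IsJointlyHomogeneous (∑ i ∈ s, G i) p := by
  intro a
  rw [coeff_sum]
  exact ⟨fun e he => IsHomogeneous.sum _ _ _ fun i hi => (h i hi a).1 e he,
    fun ha => Finset.sum_eq_zero fun i hi => (h i hi a).2 ha⟩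

lemma mul (hG : IsJointlyHomogeneous G p) (hH : IsJointlyHomogeneous H q) :
    IsJointlyHomogeneous (G * H) (p + q) := by
  classical
  intro a
  rw [coeff_mul]
  refine ⟨fun e he => IsHomogeneous.sum _ _ _ fun x hx => ?_,
    fun ha => Finset.sum_eq_zero fun x hx => ?_⟩
  all_goals
    have hdeg : x.1.degree + x.2.degree = a.degree := by
      rw [← map_add, Finset.HasAntidiagonal.mem_antidiagonal.mp hx]
  · rcases lt_or_ge p x.1.degree with h1 | h1
    · rw [(hG x.1).2 h1, zero_mul]
      exact isHomogeneous_zero _ _ _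
    rcases lt_or_ge q x.2.degree with h2 | h2
    · rw [(hH x.2).2 h2, mul_zero]
      exact isHomogeneous_zero _ _ _
    obtain ⟨u, hu⟩ := Nat.exists_eq_add_of_le h1
    obtain ⟨v, hv⟩ := Nat.exists_eq_add_of_le h2
    obtain rfl : e = u + v := by omega
    exact ((hG x.1).1 u hu.symm).mul ((hH x.2).1 v hv.symm)
  · rcases lt_or_ge p x.1.degree with h1 | h1
    · rw [(hG x.1).2 h1, zero_mul]
    · rw [(hH x.2).2 (by omega), mul_zero]

lemma one : IsJointlyHomogeneous (1 : MvPolynomial σ (MvPolynomial σ F)) 0 := by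
  simpa using IsJointlyHomogeneous.algebraMap (σ := σ) (1 : F)

lemma pow (hG : IsJointlyHomogeneous G p) (e : ℕ) : IsJointlyHomogeneous (G ^ e) (e * p) := by
  induction e with
  | zero => simpa using one
  | succ e ih => rw [pow_succ, add_mul, one_mul]; exact ih.mul hG

lemma prod {ι : Type*} (s : Finset ι) {G : ι → MvPolynomial σ (MvPolynomial σ F)} {w : ι → ℕ}
    (h : ∀ i ∈ s, IsJointlyHomogeneous (G i) (w i)) :
    IsJointlyHomogeneous (∏ i ∈ s, G i) (∑ i ∈ s, w i) := by
  classical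
  induction s using Finset.induction_on with
  | empty => simpa using one
  | insert i s hi ih =>
    rw [Finset.prod_insert hi, Finset.sum_insert hi]
    exact (h i (Finset.mem_insert_self i s)).mul
      (ih fun j hj => h j (Finset.mem_insert_of_mem hj))

lemma taylorHom {P : MvPolynomial σ F} {d : ℕ} (hP : P.IsHomogeneous d) :
    IsJointlyHomogeneous (taylorHom P) d := by
  rw [← support_sum_monomial_coeff P, map_sum]
  refine sum _ fun s hs => ?_
  have hd : d = s.degree := hP.degree_eq_sum_deg_support hs
  rw [_root_.taylorHom, aeval_monomial, hd, ← zero_add s.degree]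
  refine (algebraMap _).mul ?_
  rw [Finsupp.prod, Finsupp.degree_apply]
  refine prod _ fun i _ => ?_
  simpa using (C_X_add_X i).pow (s i)

end IsJointlyHomogeneous

end TaylorExpansion

section Components

variable {σ F : Type*} [CommRing F]

/-- The part of `P(x + y)` of degree `e` in `y`. -/
noncomputable def taylorPart (e : ℕ) (P : MvPolynomial σ F) :
    MvPolynomial σ (MvPolynomial σ F) :=
  homogeneousComponent e (taylorHom P)

lemma taylorHom_eq_sum_taylorPart {P : MvPolynomial σ F} {d : ℕ} (hP : P.IsHomogeneous d) :
    taylorHom P = ∑ e ∈ Finset.range (d + 1), taylorPart e P := by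
  ext1 a
  simp only [taylorPart, coeff_sum, coeff_homogeneousComponent, Finset.sum_ite_eq,
    Finset.mem_range]
  split_ifs with h
  · rfl
  · exact (IsJointlyHomogeneous.taylorHom hP a).2 (by omega)

lemma isHomogeneous_coeff_taylorPart {P : MvPolynomial σ F} {d e : ℕ} (hP : P.IsHomogeneous d)
    (he : e ≤ d) (a : σ →₀ ℕ) : (coeff a (taylorPart e P)).IsHomogeneous (d - e) := by
  rw [taylorPart, coeff_homogeneousComponent]
  split_ifs with h
  · exact (IsJointlyHomogeneous.taylorHom hP a).1 _ (by omega)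
  · exact isHomogeneous_zero _ _ _

lemma isHomogeneous_coeff_prod {ι : Type*} (s : Finset ι)
    {G : ι → MvPolynomial σ (MvPolynomial σ F)} {w : ι → ℕ}
    (h : ∀ i ∈ s, ∀ a, (coeff a (G i)).IsHomogeneous (w i)) (a : σ →₀ ℕ) :
    (coeff a (∏ i ∈ s, G i)).IsHomogeneous (∑ i ∈ s, w i) := by
  classical
  induction s using Finset.induction_on generalizing a with
  | empty =>
    rw [Finset.prod_empty, Finset.sum_empty, coeff_one]
    split_ifs
    · exact isHomogeneous_one _ _
    · exact isHomogeneous_zero _ _ _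
  | insert i s hi ih =>
    rw [Finset.prod_insert hi, Finset.sum_insert hi, coeff_mul]
    exact IsHomogeneous.sum _ _ _ fun x _ => (h i (Finset.mem_insert_self i s) _).mul
      (ih (fun j hj => h j (Finset.mem_insert_of_mem hj)) _)

end Components

lemma prod_sum_eq_sum_piFinset {ι R : Type*} [Fintype ι] [DecidableEq ι] [CommRing R]
    (s : Finset ι) (E : ι → Finset ℕ) (f : ι → ℕ → R) :
    ∏ i ∈ s, ∑ e ∈ E i, f i e =
      ∑ κ ∈ Fintype.piFinset fun i => if i ∈ s then E i else {0}, ∏ i ∈ s, f i (κ i) := by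
  have h (κ : ι → ℕ) : ∏ i ∈ s, f i (κ i) = ∏ i, if i ∈ s then f i (κ i) else 1 := by
    rw [Finset.prod_ite_mem, Finset.univ_inter]
  simp only [h]
  rw [← Finset.prod_univ_sum (fun i => if i ∈ s then E i else {0})
    (fun i e => if i ∈ s then f i e else 1), ← Finset.univ_inter s, ← Finset.prod_ite_mem]
  refine Finset.prod_congr rfl fun i _ => ?_
  by_cases hi : i ∈ s <;> simp [hi]

section Residue

variable {t : ℕ} {ds : Fin t → ℕ} {k d : ℕ}

lemma residue_le (k : ℕ) (ds : Fin t → ℕ) (κ : Fin t → ℕ) :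
    residue k ds ≤
      (1 / 2) * ∑ i, |(κ i : ℝ) - ((k : ℝ) / ((∑ i, ds i : ℕ) : ℝ)) * (ds i : ℝ)| := by
  unfold residue
  gcongr
  refine csInf_le ⟨0, ?_⟩ ⟨fun i => (κ i : ℤ), by simp⟩
  rintro _ ⟨κ, rfl⟩
  positivity

/-- The admissibility condition on the pair `(k₀, ℓ₀)`. -/
def Admissible (k d : ℕ) (ds : Fin t → ℕ) (k0 ℓ0 : ℕ) : Prop :=
  (k0 : ℝ) + ((k : ℝ) / ((d : ℝ) - (k : ℝ))) * (ℓ0 : ℝ) ≤ (k : ℝ) - residue k ds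

lemma admissible_zero (hd : d = ∑ i, ds i) (hk : k < d) : Admissible k d ds 0 0 := by
  have h := residue_le k ds 0
  have hd0 : (0 : ℝ) < d := by exact_mod_cast (by omega : 0 < d)
  have hsum : ∑ i, |((0 : Fin t → ℕ) i : ℝ) - ((k : ℝ) / (d : ℝ)) * (ds i : ℝ)| = k := by
    have habs (i : Fin t) : |((0 : Fin t → ℕ) i : ℝ) - ((k : ℝ) / (d : ℝ)) * (ds i : ℝ)| =
        ((k : ℝ) / (d : ℝ)) * (ds i : ℝ) := by
      rw [Pi.zero_apply, Nat.cast_zero, zero_sub, abs_neg, abs_of_nonneg (by positivity)]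
    rw [Finset.sum_congr rfl fun i _ => habs i, ← Finset.mul_sum, ← Nat.cast_sum, ← hd,
      div_mul_cancel₀ _ hd0.ne']
  rw [← hd, hsum] at h
  have hk0 : (0 : ℝ) ≤ k := Nat.cast_nonneg k
  simp only [Admissible, Nat.cast_zero, mul_zero, add_zero]
  linarith

/-- A distribution `κ` of `k` that is at most proportional to `ds` on `S` and at least proportional
to `ds` off `S` yields an admissible pair. -/
lemma admissible_of_distribution (hd : d = ∑ i, ds i) (hk : k < d) (S : Finset (Fin t))
    (κ : Fin t → ℕ) (hS : ∀ i ∈ S, κ i * d ≤ k * ds i)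
    (hSc : ∀ i ∈ Sᶜ, k * ds i < κ i * d ∧ κ i ≤ ds i) (hκ : ∑ i, κ i = k) :
    Admissible k d ds (∑ i ∈ S, κ i) (∑ i ∈ Sᶜ, (ds i - κ i)) := by
  have hdk : (0 : ℝ) < (d : ℝ) - k := sub_pos.mpr (by exact_mod_cast hk)
  have hd0 : (0 : ℝ) < d := by exact_mod_cast (by omega : 0 < d)
  have hk0 : (0 : ℝ) ≤ k := Nat.cast_nonneg k
  have hres := residue_le k ds κ
  rw [← hd, ← Finset.sum_add_sum_compl S] at hres
  have habsS : ∑ i ∈ S, |(κ i : ℝ) - (k : ℝ) / d * ds i| =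
      (k : ℝ) / d * ∑ i ∈ S, (ds i : ℝ) - ∑ i ∈ S, (κ i : ℝ) := by
    rw [Finset.mul_sum, ← Finset.sum_sub_distrib]
    refine Finset.sum_congr rfl fun i hi => ?_
    rw [abs_of_nonpos, neg_sub]
    have h : (κ i : ℝ) * d ≤ k * ds i := by exact_mod_cast hS i hi
    rw [sub_nonpos, div_mul_eq_mul_div, le_div_iff₀ hd0]
    exact h
  have hpos : ∀ i ∈ Sᶜ, 0 ≤ (κ i : ℝ) - (k : ℝ) / d * ds i := by
    intro i hi
    have h : (k : ℝ) * ds i ≤ κ i * d := by exact_mod_cast (hSc i hi).1.le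
    rw [sub_nonneg, div_mul_eq_mul_div, div_le_iff₀ hd0]
    exact h
  have habsSc : ∑ i ∈ Sᶜ, |(κ i : ℝ) - (k : ℝ) / d * ds i| =
      ∑ i ∈ Sᶜ, (κ i : ℝ) - (k : ℝ) / d * ∑ i ∈ Sᶜ, (ds i : ℝ) := by
    rw [Finset.mul_sum, ← Finset.sum_sub_distrib]
    exact Finset.sum_congr rfl fun i hi => abs_of_nonneg (hpos i hi)
  have hnonneg : 0 ≤ ∑ i ∈ Sᶜ, (κ i : ℝ) - (k : ℝ) / d * ∑ i ∈ Sᶜ, (ds i : ℝ) := by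
    rw [← habsSc]
    positivity
  have hκsum : ∑ i ∈ S, (κ i : ℝ) + ∑ i ∈ Sᶜ, (κ i : ℝ) = k := by
    rw [Finset.sum_add_sum_compl]
    exact_mod_cast hκ
  have hdsum : ∑ i ∈ S, (ds i : ℝ) + ∑ i ∈ Sᶜ, (ds i : ℝ) = d := by
    rw [Finset.sum_add_sum_compl]
    exact_mod_cast hd.symm
  have hℓ : ((∑ i ∈ Sᶜ, (ds i - κ i) : ℕ) : ℝ) =
      ∑ i ∈ Sᶜ, (ds i : ℝ) - ∑ i ∈ Sᶜ, (κ i : ℝ) := by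
    rw [Nat.cast_sum, ← Finset.sum_sub_distrib]
    exact Finset.sum_congr rfl fun i hi => Nat.cast_sub (hSc i hi).2
  rw [Admissible, hℓ, Nat.cast_sum]
  rw [habsS, habsSc] at hres
  generalize ∑ i ∈ S, (κ i : ℝ) = a at *
  generalize ∑ i ∈ Sᶜ, (κ i : ℝ) = b at *
  generalize ∑ i ∈ S, (ds i : ℝ) = u at *
  generalize ∑ i ∈ Sᶜ, (ds i : ℝ) = v at *
  have hbal : (k : ℝ) / d * u - a = b - (k : ℝ) / d * v := by
    have : (k : ℝ) / d * (u + v) = k := by rw [hdsum, div_mul_cancel₀ _ hd0.ne']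
    linarith
  have hresb : residue k ds ≤ b - (k : ℝ) / d * v := by linarith
  have hid : a + (k : ℝ) / (d - k) * (v - b) =
      k - (b - (k : ℝ) / d * v) - (k : ℝ) / (d - k) * (b - (k : ℝ) / d * v) := by
    rw [show a = k - b by linarith]
    field_simp
    ring
  have : 0 ≤ (k : ℝ) / (d - k) * (b - (k : ℝ) / d * v) := by positivity
  linarith

end Residue

section ProductExpansion

variable {F : Type*} [Field F] {n t : ℕ}

/-- The span of the products `h · D_m (∏ i ∈ S, Q i)` with `h` homogeneous, over all subsets `S` and
admissible pairs `(|m|, deg h)`. -/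
noncomputable def admissibleSpan (k d : ℕ) (ds : Fin t → ℕ) (Q : Fin t → MvPolynomial (Fin n) F) :
    Submodule F (MvPolynomial (Fin n) F) :=
  Submodule.span F {g | ∃ (S : Finset (Fin t)) (m : Fin n →₀ ℕ) (ℓ : ℕ)
    (h : MvPolynomial (Fin n) F), Admissible k d ds m.degree ℓ ∧ m.degree ≤ k ∧
      ℓ + k = ∑ i ∈ Sᶜ, ds i + m.degree ∧ h.IsHomogeneous ℓ ∧ g = h * hasse m (∏ i ∈ S, Q i)}

variable {k d : ℕ} {ds : Fin t → ℕ} {Q : Fin t → MvPolynomial (Fin n) F}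

lemma coeff_prod_small_eq_zero (hd : d = ∑ i, ds i) (hk : k < d) (S : Finset (Fin t))
    (κ : Fin t → ℕ) (hκ : ∀ i ∈ Sᶜ, k * ds i < κ i * d ∧ κ i ≤ ds i) (m : Fin n →₀ ℕ)
    (hm : m.degree + ∑ i ∈ Sᶜ, κ i = k)
    (hbad : ¬ Admissible k d ds m.degree (∑ i ∈ Sᶜ, (ds i - κ i))) :
    coeff m (∏ i ∈ S, ∑ e ∈ Finset.range (ds i + 1) with e * d ≤ k * ds i,
      taylorPart e (Q i)) = 0 := by
  rw [prod_sum_eq_sum_piFinset, coeff_sum]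
  refine Finset.sum_eq_zero fun μ hμ => ?_
  have hhom := IsHomogeneous.prod S (fun i => taylorPart (μ i) (Q i)) μ
    fun i _ => homogeneousComponent_isHomogeneous _ _
  refine hhom.coeff_eq_zero fun hdeg => hbad ?_
  have hμS : ∀ i ∈ S, μ i * d ≤ k * ds i := by
    intro i hi
    have := Fintype.mem_piFinset.mp hμ i
    rw [if_pos hi, Finset.mem_filter] at this
    exact this.2
  have hS : ∑ i ∈ S, (if i ∈ S then μ i else κ i) = ∑ i ∈ S, μ i :=
    Finset.sum_congr rfl fun i hi => if_pos hi
  have hSc : ∀ i ∈ Sᶜ, (if i ∈ S then μ i else κ i) = κ i :=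
    fun i hi => if_neg (Finset.mem_compl.mp hi)
  have := admissible_of_distribution hd hk S (fun i => if i ∈ S then μ i else κ i)
    (fun i hi => by simpa [hi] using hμS i hi)
    (fun i hi => by simpa only [hSc i hi] using hκ i hi)
    (by rw [← Finset.sum_add_sum_compl S, hS, Finset.sum_congr rfl hSc, ← hdeg, hm])
  rw [hS, ← hdeg] at this
  rwa [Finset.sum_congr rfl fun i hi => by rw [hSc i hi]] at this

lemma hasse_prod_eq_neg_sum (hhom : ∀ i, (Q i).IsHomogeneous (ds i)) (S : Finset (Fin t))
    (m : Fin n →₀ ℕ)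
    (hzero : coeff m (∏ i ∈ S, ∑ e ∈ Finset.range (ds i + 1) with e * d ≤ k * ds i,
      taylorPart e (Q i)) = 0) :
    hasse m (∏ i ∈ S, Q i) = -∑ T ∈ S.ssubsets, ∑ μ ∈ Fintype.piFinset fun i =>
      if i ∈ S \ T then {e ∈ Finset.range (ds i + 1) | ¬ e * d ≤ k * ds i} else {0},
        ∑ x ∈ Finset.HasAntidiagonal.antidiagonal m, hasse x.1 (∏ i ∈ T, Q i) *
          coeff x.2 (∏ i ∈ S \ T, -taylorPart (μ i) (Q i)) := by
  have hsplit (i : Fin t) : ∑ e ∈ Finset.range (ds i + 1) with e * d ≤ k * ds i,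
      taylorPart e (Q i) = taylorHom (Q i) +
        ∑ e ∈ Finset.range (ds i + 1) with ¬ e * d ≤ k * ds i, -taylorPart e (Q i) := by
    rw [taylorHom_eq_sum_taylorPart (hhom i), Finset.sum_neg_distrib, ← sub_eq_add_neg,
      eq_sub_iff_add_eq, Finset.sum_filter_add_sum_filter_not]
  rw [Finset.prod_congr rfl fun i _ => hsplit i, Finset.prod_add,
    ← Finset.add_sum_erase _ _ (Finset.mem_powerset_self S), Finset.sdiff_self,
    Finset.prod_empty, mul_one, coeff_add, ← map_prod] at hzero
  rw [hasse, eq_neg_of_add_eq_zero_left hzero, coeff_sum, Finset.ssubsets]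
  congr 1
  refine Finset.sum_congr rfl fun T _ => ?_
  rw [prod_sum_eq_sum_piFinset, Finset.mul_sum, coeff_sum, ← map_prod]
  exact Finset.sum_congr rfl fun μ _ => coeff_mul _ _ _

lemma mul_hasse_prod_mem_admissibleSpan (hd : d = ∑ i, ds i) (hk : k < d)
    (hhom : ∀ i, (Q i).IsHomogeneous (ds i)) (S : Finset (Fin t)) (κ : Fin t → ℕ)
    (hκ : ∀ i ∈ Sᶜ, k * ds i < κ i * d ∧ κ i ≤ ds i) (m : Fin n →₀ ℕ)
    (hm : m.degree + ∑ i ∈ Sᶜ, κ i = k) (h : MvPolynomial (Fin n) F)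
    (hh : h.IsHomogeneous (∑ i ∈ Sᶜ, (ds i - κ i))) :
    h * hasse m (∏ i ∈ S, Q i) ∈ admissibleSpan k d ds Q := by
  induction S using Finset.strongInduction generalizing κ m h with
  | H S ih =>
  by_cases hadm : Admissible k d ds m.degree (∑ i ∈ Sᶜ, (ds i - κ i))
  · refine Submodule.subset_span ⟨S, m, _, h, hadm, by omega, ?_, hh, rfl⟩
    have : ∑ i ∈ Sᶜ, (ds i - κ i) + ∑ i ∈ Sᶜ, κ i = ∑ i ∈ Sᶜ, ds i := by
      rw [← Finset.sum_add_distrib]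
      exact Finset.sum_congr rfl fun i hi => Nat.sub_add_cancel (hκ i hi).2
    omega
  rw [hasse_prod_eq_neg_sum hhom S m (coeff_prod_small_eq_zero hd hk S κ hκ m hm hadm), mul_neg]
  simp only [Finset.mul_sum]
  refine Submodule.neg_mem _ (Submodule.sum_mem _ fun T hT => Submodule.sum_mem _ fun μ hμ =>
    Submodule.sum_mem _ fun x hx => ?_)
  have hTS : T ⊂ S := Finset.mem_ssubsets.mp hT
  have hμ' : ∀ i ∈ S \ T, k * ds i < μ i * d ∧ μ i ≤ ds i := by
    intro i hi
    have := Fintype.mem_piFinset.mp hμ i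
    rw [if_pos hi, Finset.mem_filter, Finset.mem_range] at this
    omega
  have hhomog := IsHomogeneous.prod (S \ T) (fun i => -taylorPart (μ i) (Q i)) μ
    fun i _ => (homogeneousComponent_isHomogeneous _ _).neg
  by_cases hdeg : x.2.degree = ∑ i ∈ S \ T, μ i
  swap
  · rw [hhomog.coeff_eq_zero hdeg, mul_zero, mul_zero]
    exact Submodule.zero_mem _
  have hxdeg : x.1.degree + x.2.degree = m.degree := by
    rw [← map_add, Finset.HasAntidiagonal.mem_antidiagonal.mp hx]
  have hdisj : Disjoint Sᶜ (S \ T) :=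
    Finset.disjoint_left.mpr fun i hi hi' =>
      Finset.mem_compl.mp hi (Finset.mem_sdiff.mp hi').1
  have hcompl : Tᶜ = Sᶜ ∪ (S \ T) := by
    ext i
    have := @hTS.1 i
    simp only [Finset.mem_compl, Finset.mem_union, Finset.mem_sdiff]
    tauto
  have hν : ∀ i ∈ Sᶜ, (if i ∈ S then μ i else κ i) = κ i :=
    fun i hi => if_neg (Finset.mem_compl.mp hi)
  have hν' : ∀ i ∈ S \ T, (if i ∈ S then μ i else κ i) = μ i :=
    fun i hi => if_pos (Finset.mem_sdiff.mp hi).1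
  rw [mul_left_comm, mul_comm]
  have hsum (f : Fin t → ℕ → ℕ) :
      ∑ i ∈ Tᶜ, f i (if i ∈ S then μ i else κ i) =
        ∑ i ∈ Sᶜ, f i (κ i) + ∑ i ∈ S \ T, f i (μ i) := by
    rw [hcompl, Finset.sum_union hdisj]
    exact congrArg₂ _ (Finset.sum_congr rfl fun i hi => by rw [hν i hi])
      (Finset.sum_congr rfl fun i hi => by rw [hν' i hi])
  refine ih T hTS (fun i => if i ∈ S then μ i else κ i) (fun i hi => ?_) x.1 ?_ _ ?_
  · rw [hcompl, Finset.mem_union] at hi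
    rcases hi with hi | hi
    · simpa only [hν i hi] using hκ i hi
    · simpa only [hν' i hi] using hμ' i hi
  · rw [hsum fun _ e => e]
    omega
  · rw [hsum fun i e => ds i - e]
    refine hh.mul (isHomogeneous_coeff_prod _ (fun i hi a => ?_) _)
    rw [coeff_neg]
    exact (isHomogeneous_coeff_taylorPart (hhom i) (hμ' i hi).2 a).neg

end ProductExpansion

section Projection

variable {F : Type*} [Field F] {n t : ℕ}

lemma exists_sym_toFinsupp_eq {σ : Type*} [DecidableEq σ] (m : σ →₀ ℕ) :
    ∃ s : Sym σ m.degree, Multiset.toFinsupp (s : Multiset σ) = m :=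
  ⟨⟨Finsupp.toMultiset m, Finsupp.card_toMultiset m⟩, Finsupp.toMultiset_toFinsupp m⟩

/-- The pairs `(S, k₀)` for which the degree `ℓ₀` forced by homogeneity makes `(k₀, ℓ₀)`
admissible. -/
abbrev AdmissibleIndex (k d : ℕ) (ds : Fin t → ℕ) : Type :=
  {p : Finset (Fin t) × Fin (k + 1) //
    Admissible k d ds p.2 (∑ i ∈ p.1ᶜ, ds i + p.2 - k)}

variable {k d n0 : ℕ} {ds : Fin t → ℕ} {Q : Fin t → MvPolynomial (Fin n) F}

/-- Spanning family for the projection of `admissibleSpan`. -/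
noncomputable def projectedFamily (k d : ℕ) (ds : Fin t → ℕ) (Q : Fin t → MvPolynomial (Fin n) F)
    (L : Fin n → MvPolynomial (Fin n0) F) :
    (Σ p : AdmissibleIndex k d ds, Sym (Fin n) p.1.2 ×
      Sym (Fin n0) (∑ i ∈ p.1.1ᶜ, ds i + p.1.2 - k)) → MvPolynomial (Fin n0) F :=
  fun q => monomial (Multiset.toFinsupp (q.2.2 : Multiset (Fin n0))) 1 *
    aeval L (hasse (Multiset.toFinsupp (q.2.1 : Multiset (Fin n))) (∏ i ∈ q.1.1.1, Q i))

lemma admissibleSpan_le_comap_span (L : Fin n → MvPolynomial (Fin n0) F)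
    (hL : ∀ i, (L i).IsHomogeneous 1) :
    admissibleSpan k d ds Q ≤
      (Submodule.span F (Set.range (projectedFamily k d ds Q L))).comap
        (aeval L).toLinearMap := by
  refine Submodule.span_le.mpr ?_
  rintro _ ⟨S, m, ℓ, h, hadm, hmk, hℓ, hh, rfl⟩
  obtain rfl : ℓ = ∑ i ∈ Sᶜ, ds i + m.degree - k := by omega
  have hh' : (aeval L h).IsHomogeneous (∑ i ∈ Sᶜ, ds i + m.degree - k) := by
    simpa using hh.aeval L hL
  change aeval L (h * hasse m (∏ i ∈ S, Q i)) ∈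
    Submodule.span F (Set.range (projectedFamily k d ds Q L))
  rw [map_mul, ← support_sum_monomial_coeff (aeval L h), Finset.sum_mul]
  refine Submodule.sum_mem _ fun b hb => ?_
  have hbdeg : b.degree = ∑ i ∈ Sᶜ, ds i + m.degree - k :=
    (hh'.degree_eq_sum_deg_support hb).symm
  obtain ⟨s, hs⟩ := exists_sym_toFinsupp_eq m
  obtain ⟨u, hu⟩ := exists_sym_toFinsupp_eq b
  rw [← mul_one (coeff b _), ← smul_eq_mul _ (1 : F), ← smul_monomial, smul_mul_assoc]
  refine Submodule.smul_mem _ _ (Submodule.subset_span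
    ⟨⟨⟨(S, ⟨m.degree, by omega⟩), hadm⟩, s, Sym.cast hbdeg u⟩, ?_⟩)
  simp only [projectedFamily, Sym.coe_cast, hs, hu]

lemma finrank_span_aeval_partialsSet_le (hd : d = ∑ i, ds i) (hk : k < d)
    (hhom : ∀ i, (Q i).IsHomogeneous (ds i)) (L : Fin n → MvPolynomial (Fin n0) F)
    (hL : ∀ i, (L i).IsHomogeneous 1) {B : ℕ}
    (hB : ∀ k0 ≤ k, ∀ ℓ0 ≤ d, Admissible k d ds k0 ℓ0 → M n k0 * M n0 ℓ0 ≤ B) :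
    Module.finrank F (Submodule.span F ((fun g => aeval L g) '' partialsSet k (∏ i, Q i))) ≤
      2 ^ t * (k + 1) * B := by
  classical
  have hle : Submodule.span F ((fun g => aeval L g) '' partialsSet k (∏ i, Q i)) ≤
      Submodule.span F (Set.range (projectedFamily k d ds Q L)) := by
    refine Submodule.span_le.mpr ?_
    rintro _ ⟨_, ⟨m, hm, rfl⟩, rfl⟩
    obtain ⟨c, hc⟩ := exists_iterDeriv_eq_smul_hasse m (∏ i, Q i)
    have hmem := mul_hasse_prod_mem_admissibleSpan hd hk hhom Finset.univ 0 (by simp) m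
      (by simpa using (show m.degree = k from hm)) 1 (by simpa using isHomogeneous_one _ _)
    rw [one_mul] at hmem
    beta_reduce
    rw [hc]
    exact admissibleSpan_le_comap_span L hL (Submodule.smul_mem _ c hmem)
  have : Module.Finite F (Submodule.span F (Set.range (projectedFamily k d ds Q L))) :=
    Module.Finite.span_of_finite F (Set.finite_range _)
  have : Fintype (AdmissibleIndex k d ds) := Fintype.ofFinite _
  refine (Submodule.finrank_mono hle).trans ((finrank_range_le_card _).trans ?_)
  rw [Fintype.card_sigma]
  have hcard : Fintype.card (AdmissibleIndex k d ds) ≤ 2 ^ t * (k + 1) := by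
    refine (Fintype.card_subtype_le _).trans_eq ?_
    simp
  refine (Finset.sum_le_card_nsmul _ _ B fun p _ => ?_).trans
    (by rw [smul_eq_mul, Finset.card_univ]; exact Nat.mul_le_mul_right B hcard)
  rw [Fintype.card_prod, Sym.card_sym_eq_choose, Sym.card_sym_eq_choose, Fintype.card_fin,
    Fintype.card_fin]
  have hp : (p.1.2 : ℕ) ≤ k := Nat.lt_succ_iff.mp p.1.2.2
  have hS : ∑ i ∈ p.1.1ᶜ, ds i ≤ d :=
    (Finset.sum_le_univ_sum_of_nonneg fun _ => Nat.zero_le _).trans_eq hd.symm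
  exact hB _ hp _ (by omega) p.2

end Projection

/-- upper bound on the affine projections of partials of a product. -/
theorem stmt2 {F : Type*} [Field F] {n t : ℕ} (hn : 0 < n) (ht : 0 < t)
    (Q : Fin t → MvPolynomial (Fin n) F) (ds : Fin t → ℕ)
    (hhom : ∀ i, (Q i).IsHomogeneous (ds i)) (hpos : ∀ i, 1 ≤ ds i)
    (d : ℕ) (hd : d = ∑ i, ds i) (hd1 : 1 ≤ d)
    (k n0 : ℕ) (hk : k < d) (hn0 : 1 ≤ n0) (hn0n : n0 ≤ n) :
    ∃ k0 ℓ0 : ℕ,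
      (k0 : ℝ) + ((k : ℝ) / ((d : ℝ) - (k : ℝ))) * (ℓ0 : ℝ) ≤ (k : ℝ) - residue k ds ∧
      APP k n0 (∏ i, Q i) ≤ 2 ^ t * d ^ 2 * (M n k0 * M n0 ℓ0) := by
  classical
  let pairs : Finset (ℕ × ℕ) :=
    {p ∈ Finset.range (k + 1) ×ˢ Finset.range (d + 1) | Admissible k d ds p.1 p.2}
  have hne : pairs.Nonempty := ⟨(0, 0), by simp [pairs, admissible_zero hd hk]⟩
  obtain ⟨⟨k0, ℓ0⟩, hmem, hmax⟩ := pairs.exists_max_image (fun p => M n p.1 * M n0 p.2) hne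
  refine ⟨k0, ℓ0, (Finset.mem_filter.mp hmem).2, csSup_le' ?_⟩
  rintro _ ⟨L, hL, rfl⟩
  refine (finrank_span_aeval_partialsSet_le (B := M n k0 * M n0 ℓ0) hd hk hhom L hL
    fun a ha b hb hab => hmax (a, b) ?_).trans ?_
  · simp only [pairs, Finset.mem_filter, Finset.mem_product, Finset.mem_range]
    exact ⟨⟨by omega, by omega⟩, hab⟩
  · gcongr
    nlinarith
end

section
/- There exist absolute constants c_2, c_3 > 0 such that for every real c_1 ≥ 0 the following holds. Let F be a field and let P = Σ_{i=1}^s Q_{i,1}⋯Q_{i,t_i} be a homogeneous polynomial of degree d ≥ 1 in F[x_1,…,x_n], where each Q_{i,j} is homogeneous and nonconstant. Let k be an integer with 1 ≤ k < d/2 and let n_0 be an integer with d ≤ n_0 ≤ n and (d−k)·(n/k)^{k/(d−k)} ≤ n_0 ≤ 2(d−k)·(n/k)^{k/(d−k)}. Suppose APP_{k,n_0}(P) ≥ 2^{−c_1·d}·M(n,k), and suppose there exists γ > 0 such that residue_k(deg Q_{i,1}, …, deg Q_{i,t_i}) ≥ γ for every i ∈ [s]. Then s ≥ 2^{−(c_1+c_2)·d}·(n/d)^{c_3·γ}.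 -/
open MvPolynomial

section Taylor

variable {σ τ F : Type*} [Field F]

/-- The substitution `x_i ↦ L(x_i) + y_i`, as a polynomial in `y` with coefficients in `F[z]`. -/
noncomputable def taylorShift (L : σ → MvPolynomial τ F) :
    MvPolynomial σ F →ₐ[F] MvPolynomial σ (MvPolynomial τ F) :=
  aeval fun i => C (L i) + X i

theorem pderiv_taylorShift (L : σ → MvPolynomial τ F) (i : σ) (p : MvPolynomial σ F) :
    pderiv i (taylorShift L p) = taylorShift L (pderiv i p) := by
  classical
  induction p using MvPolynomial.induction_on with
  | C a => simp [taylorShift, IsScalarTower.algebraMap_apply F (MvPolynomial τ F)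
      (MvPolynomial σ (MvPolynomial τ F)), MvPolynomial.algebraMap_eq]
  | add p q hp hq => simp [hp, hq]
  | mul_X p j hp =>
    rw [map_mul, pderiv_mul, hp, pderiv_mul, map_add, map_mul, map_mul]
    congr 2
    by_cases h : j = i
    · subst h; simp [taylorShift]
    · simp [taylorShift, pderiv_X_of_ne h]

theorem coeff_zero_taylorShift (L : σ → MvPolynomial τ F) (p : MvPolynomial σ F) :
    coeff 0 (taylorShift L p) = aeval L p := by
  have h : ((constantCoeff (σ := σ) (R := MvPolynomial τ F)).comp
      (taylorShift L : MvPolynomial σ F →+* _)) = (aeval L : MvPolynomial σ F →ₐ[F] _) := by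
    apply MvPolynomial.ringHom_ext
    · intro r
      simp [taylorShift, IsScalarTower.algebraMap_apply F (MvPolynomial τ F)
        (MvPolynomial σ (MvPolynomial τ F)), MvPolynomial.algebraMap_eq]
    · intro i; simp [taylorShift]
  exact congrArg (fun f => f p) h

theorem iterDeriv_taylorShift (L : σ → MvPolynomial τ F) (m : σ →₀ ℕ) (p : MvPolynomial σ F) :
    iterDeriv m (taylorShift L p) = taylorShift L (iterDeriv m p) := by
  unfold iterDeriv
  induction m.support.toList with
  | nil => simp
  | cons i l ih =>
    simp only [List.map_cons, List.prod_cons, Module.End.mul_apply, ih]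
    generalize (List.map (fun i => ((pderiv i).toLinearMap :
      Module.End F (MvPolynomial σ F)) ^ m i) l).prod p = q
    induction m i with
    | zero => simp
    | succ e he => simp [pow_succ', he, pderiv_taylorShift]

theorem exists_coeff_pderiv_pow {R : Type*} [CommRing R] (i : σ) (e : ℕ) (n : σ →₀ ℕ) :
    ∃ N : ℕ, ∀ p : MvPolynomial σ R,
      coeff n ((((pderiv i).toLinearMap : Module.End R (MvPolynomial σ R)) ^ e) p)
        = N * coeff (n + Finsupp.single i e) p := by
  induction e generalizing n with
  | zero => exact ⟨1, by simp⟩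
  | succ e ih =>
    obtain ⟨N, hN⟩ := ih (n + Finsupp.single i 1)
    refine ⟨(n i + 1) * N, fun p => ?_⟩
    rw [pow_succ', Module.End.mul_apply]
    change coeff n (pderiv i _) = _
    rw [coeff_pderiv, hN, add_assoc, ← Finsupp.single_add, add_comm 1 e]
    push_cast
    ring

theorem exists_coeff_zero_iterDeriv {R : Type*} [CommRing R] (m : σ →₀ ℕ) :
    ∃ N : ℕ, ∀ p : MvPolynomial σ R, coeff 0 (iterDeriv m p) = N * coeff m p := by
  have key : ∀ (l : List σ) (n : σ →₀ ℕ), ∃ N : ℕ, ∀ p : MvPolynomial σ R,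
      coeff n ((l.map (fun i => ((pderiv i).toLinearMap :
        Module.End R (MvPolynomial σ R)) ^ m i)).prod p)
        = N * coeff (n + (l.map fun i => Finsupp.single i (m i)).sum) p := by
    intro l
    induction l with
    | nil => exact fun n => ⟨1, by simp⟩
    | cons i l ih =>
      intro n
      obtain ⟨N₁, h₁⟩ := exists_coeff_pderiv_pow (R := R) i (m i) n
      obtain ⟨N₂, h₂⟩ := ih (n + Finsupp.single i (m i))
      refine ⟨N₁ * N₂, fun p => ?_⟩
      rw [List.map_cons, List.prod_cons, Module.End.mul_apply, h₁, h₂, List.map_cons,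
        List.sum_cons, add_assoc]
      push_cast
      ring
  obtain ⟨N, hN⟩ := key m.support.toList 0
  refine ⟨N, fun p => ?_⟩
  rw [iterDeriv, hN, zero_add, Finset.sum_map_toList]
  congr 2
  exact Finsupp.sum_single m

theorem exists_aeval_iterDeriv (L : σ → MvPolynomial τ F) (m : σ →₀ ℕ) :
    ∃ N : ℕ, ∀ p : MvPolynomial σ F,
      aeval L (iterDeriv m p) = N * coeff m (taylorShift L p) := by
  obtain ⟨N, hN⟩ := exists_coeff_zero_iterDeriv (R := MvPolynomial τ F) m
  exact ⟨N, fun p => by rw [← hN, iterDeriv_taylorShift, coeff_zero_taylorShift]⟩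

/-- A polynomial in `y` over `F[z]` whose monomials `z^a y^m` all have total degree `e`. -/
def IsBihomogeneous (G : MvPolynomial σ (MvPolynomial τ F)) (e : ℕ) : Prop :=
  ∀ m a, coeff a (coeff m G) ≠ 0 → a.degree + m.degree = e

theorem IsBihomogeneous.mul {G H : MvPolynomial σ (MvPolynomial τ F)} {e f : ℕ}
    (hG : IsBihomogeneous G e) (hH : IsBihomogeneous H f) : IsBihomogeneous (G * H) (e + f) := by
  classical
  intro m a h
  rw [coeff_mul, coeff_sum] at h
  obtain ⟨⟨m₁, m₂⟩, hm, h⟩ := Finset.exists_ne_zero_of_sum_ne_zero h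
  rw [coeff_mul] at h
  obtain ⟨⟨a₁, a₂⟩, ha, h⟩ := Finset.exists_ne_zero_of_sum_ne_zero h
  have h1 := hG _ _ (left_ne_zero_of_mul h)
  have h2 := hH _ _ (right_ne_zero_of_mul h)
  rw [Finset.HasAntidiagonal.mem_antidiagonal] at hm ha
  simp only at hm ha
  rw [← hm, ← ha, map_add, map_add]
  simp only at h1 h2
  omega

theorem isBihomogeneous_one : IsBihomogeneous (1 : MvPolynomial σ (MvPolynomial τ F)) 0 := by
  classical
  intro m a h
  rw [coeff_one] at h
  split_ifs at h with hm
  · rw [coeff_one] at h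
    split_ifs at h with ha
    · simp [← hm, ← ha]
    · simp at h
  · simp at h

theorem IsBihomogeneous.prod {ι : Type*} (s : Finset ι)
    {G : ι → MvPolynomial σ (MvPolynomial τ F)} {e : ι → ℕ}
    (h : ∀ i ∈ s, IsBihomogeneous (G i) (e i)) :
    IsBihomogeneous (∏ i ∈ s, G i) (∑ i ∈ s, e i) := by
  classical
  induction s using Finset.induction_on with
  | empty => simpa using isBihomogeneous_one
  | insert i s hi ih =>
    rw [Finset.prod_insert hi, Finset.sum_insert hi]
    exact (h i (by simp)).mul (ih fun j hj => h j (by simp [hj]))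

theorem IsBihomogeneous.pow {G : MvPolynomial σ (MvPolynomial τ F)} {e : ℕ}
    (h : IsBihomogeneous G e) (r : ℕ) : IsBihomogeneous (G ^ r) (r * e) := by
  simpa using IsBihomogeneous.prod (Finset.range r) (G := fun _ => G) (e := fun _ => e)
    fun _ _ => h

theorem IsBihomogeneous.homogeneousComponent {G : MvPolynomial σ (MvPolynomial τ F)} {e : ℕ}
    (h : IsBihomogeneous G e) (j : ℕ) :
    IsBihomogeneous (MvPolynomial.homogeneousComponent j G) e := by
  classical
  intro m a hne
  rw [coeff_homogeneousComponent] at hne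
  split_ifs at hne with hm
  · exact h m a hne
  · simp at hne

theorem isBihomogeneous_taylorShift {L : σ → MvPolynomial τ F} (hL : ∀ i, (L i).IsHomogeneous 1)
    {p : MvPolynomial σ F} {e : ℕ} (hp : p.IsHomogeneous e) :
    IsBihomogeneous (taylorShift L p) e := by
  classical
  have hX : ∀ i, IsBihomogeneous (C (L i) + X i : MvPolynomial σ (MvPolynomial τ F)) 1 := by
    intro i m a h
    rw [coeff_add, coeff_C, coeff_X, coeff_add] at h
    by_cases h0 : 0 = m
    · subst h0
      have : ¬ (Finsupp.single i 1 = (0 : σ →₀ ℕ)) := by simp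
      simp only [if_true, if_neg this, coeff_zero, add_zero] at h
      have := hL i h
      rw [Finsupp.degree_eq_weight_one, map_zero, add_zero]
      exact this
    · simp only [if_neg h0, coeff_zero, zero_add] at h
      split_ifs at h with h1
      · rw [coeff_one] at h
        split_ifs at h with h2
        · simp [← h1, ← h2]
        · simp at h
      · simp at h
  intro m a h
  rw [taylorShift, aeval_def, eval₂_eq, coeff_sum, coeff_sum] at h
  obtain ⟨x, hx, h⟩ := Finset.exists_ne_zero_of_sum_ne_zero h
  rw [IsScalarTower.algebraMap_apply F (MvPolynomial τ F)
      (MvPolynomial σ (MvPolynomial τ F)), MvPolynomial.algebraMap_eq,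
      MvPolynomial.algebraMap_eq, coeff_C_mul, coeff_C_mul] at h
  have hb : IsBihomogeneous (∏ i ∈ x.support,
      (C (L i) + X i : MvPolynomial σ (MvPolynomial τ F)) ^ x i) (∑ i ∈ x.support, x i) :=
    IsBihomogeneous.prod _ fun i _ => by simpa using (hX i).pow (x i)
  rw [hb m a (right_ne_zero_of_mul h), hp.degree_eq_sum_deg_support hx]

theorem IsBihomogeneous.sum_homogeneousComponent {G : MvPolynomial σ (MvPolynomial τ F)} {e : ℕ}
    (h : IsBihomogeneous G e) :
    ∑ j ∈ Finset.range (e + 1), MvPolynomial.homogeneousComponent j G = G := by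
  classical
  ext m a
  simp only [coeff_sum, coeff_homogeneousComponent]
  by_cases hne : coeff a (coeff m G) = 0
  · rw [hne]
    refine Finset.sum_eq_zero fun j _ => ?_
    split_ifs <;> simp [hne]
  · have := h m a hne
    rw [Finset.sum_eq_single m.degree]
    · simp
    · intro j _ hj
      simp [hj.symm]
    · intro hm
      simp only [Finset.mem_range] at hm
      omega

end Taylor

theorem card_finsuppAntidiag_univ (n k : ℕ) :
    (Finset.finsuppAntidiag (Finset.univ : Finset (Fin n)) k).card = M n k := by
  rw [Finset.card_finsuppAntidiag_nat_eq_choose, Finset.card_fin, M]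

theorem mem_finsuppAntidiag_univ {n k : ℕ} {m : Fin n →₀ ℕ} :
    m ∈ Finset.finsuppAntidiag (Finset.univ : Finset (Fin n)) k ↔ m.degree = k := by
  rw [Finset.mem_finsuppAntidiag, Finsupp.degree_eq_sum]
  simp

/-- The projected order-`k` partials of a product of homogeneous polynomials lie in the span of
few polynomials: for each way `κ` to distribute the derivatives, the factors in `S κ` are bounded
by their degree after differentiation and the others by the number of derivatives they receive. -/
theorem exists_finset_aeval_iterDeriv_prod_mem_span {F ι : Type*} [Field F] [Fintype ι]
    [DecidableEq ι] {n n0 : ℕ}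
    {Q : ι → MvPolynomial (Fin n) F} {dq : ι → ℕ} (hQ : ∀ i, (Q i).IsHomogeneous (dq i))
    {L : Fin n → MvPolynomial (Fin n0) F} (hL : ∀ i, (L i).IsHomogeneous 1)
    (k : ℕ) (S : (ι → ℕ) → Finset ι) :
    ∃ T : Finset (MvPolynomial (Fin n0) F),
      T.card ≤ ∑ κ ∈ (Fintype.piFinset fun i => Finset.range (dq i + 1)) with ∑ i, κ i = k,
        M n0 (∑ i ∈ S κ, (dq i - κ i)) * M n (∑ i ∈ (S κ)ᶜ, κ i) ∧
      ∀ m : Fin n →₀ ℕ, m.degree = k →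
        aeval L (iterDeriv m (∏ i, Q i)) ∈ Submodule.span F (T : Set (MvPolynomial (Fin n0) F)) := by
  classical
  let G : ι → ℕ → MvPolynomial (Fin n) (MvPolynomial (Fin n0) F) :=
    fun i j => homogeneousComponent j (taylorShift L (Q i))
  let U : (ι → ℕ) → Finset (MvPolynomial (Fin n0) F) := fun κ =>
    Finset.image₂ (fun a m => monomial a (1 : F) * coeff m (∏ i ∈ (S κ)ᶜ, G i (κ i)))
      (Finset.finsuppAntidiag Finset.univ (∑ i ∈ S κ, (dq i - κ i)))
      (Finset.finsuppAntidiag Finset.univ (∑ i ∈ (S κ)ᶜ, κ i))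
  refine ⟨Finset.biUnion
    {κ ∈ Fintype.piFinset fun i => Finset.range (dq i + 1) | ∑ i, κ i = k} U, ?_, ?_⟩
  · refine Finset.card_biUnion_le.trans (Finset.sum_le_sum fun κ _ => ?_)
    rw [← card_finsuppAntidiag_univ, ← card_finsuppAntidiag_univ]
    exact Finset.card_image₂_le _ _ _
  intro m hm
  obtain ⟨N, hN⟩ := exists_aeval_iterDeriv L m
  have hb : ∀ i, IsBihomogeneous (taylorShift L (Q i)) (dq i) :=
    fun i => isBihomogeneous_taylorShift hL (hQ i)
  have hexp : taylorShift L (∏ i, Q i) =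
      ∑ κ ∈ Fintype.piFinset fun i => Finset.range (dq i + 1), ∏ i, G i (κ i) := by
    rw [map_prod, ← Finset.prod_univ_sum]
    exact Finset.prod_congr rfl fun i _ => ((hb i).sum_homogeneousComponent).symm
  rw [hN, ← nsmul_eq_mul]
  refine Submodule.smul_of_tower_mem _ N ?_
  rw [hexp, coeff_sum]
  refine Submodule.sum_mem _ fun κ hκ => ?_
  have hhom : ∀ s : Finset ι, (∏ i ∈ s, G i (κ i)).IsHomogeneous (∑ i ∈ s, κ i) := fun s =>
    IsHomogeneous.prod _ _ _ fun i _ => homogeneousComponent_isHomogeneous _ _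
  by_cases hk : ∑ i, κ i = k
  swap
  · rw [(hhom Finset.univ).coeff_eq_zero (by rw [hm]; exact fun h => hk h.symm)]
    exact Submodule.zero_mem _
  refine Submodule.span_mono (s := (U κ : Set (MvPolynomial (Fin n0) F))) ?_ ?_
  · rw [Finset.coe_subset]
    exact Finset.subset_biUnion_of_mem U (by simp only [Finset.mem_filter]; exact ⟨hκ, hk⟩)
  rw [← Finset.prod_mul_prod_compl (S κ), coeff_mul]
  refine Submodule.sum_mem _ fun ⟨m₁, m₂⟩ _ => ?_
  simp only
  by_cases h₂ : m₂.degree = ∑ i ∈ (S κ)ᶜ, κ i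
  swap
  · rw [(hhom _).coeff_eq_zero h₂, mul_zero]
    exact Submodule.zero_mem _
  by_cases h₁ : m₁.degree = ∑ i ∈ S κ, κ i
  swap
  · rw [(hhom _).coeff_eq_zero h₁, zero_mul]
    exact Submodule.zero_mem _
  have hA : IsBihomogeneous (∏ i ∈ S κ, G i (κ i)) (∑ i ∈ S κ, dq i) :=
    IsBihomogeneous.prod _ fun i _ => (hb i).homogeneousComponent _
  have hdeg : ∑ i ∈ S κ, (dq i - κ i) + ∑ i ∈ S κ, κ i = ∑ i ∈ S κ, dq i := by
    rw [← Finset.sum_add_distrib]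
    refine Finset.sum_congr rfl fun i _ => ?_
    have := Fintype.mem_piFinset.1 hκ i
    rw [Finset.mem_range] at this
    omega
  rw [(coeff m₁ (∏ i ∈ S κ, G i (κ i))).as_sum, Finset.sum_mul]
  refine Submodule.sum_mem _ fun a ha => ?_
  have hda := hA m₁ a (mem_support_iff.1 ha)
  rw [← mul_one (coeff a _), ← smul_eq_mul (coeff a _) (1 : F), ← smul_monomial, smul_mul_assoc]
  refine Submodule.smul_mem _ _ (Submodule.subset_span ?_)
  rw [Finset.mem_coe, Finset.mem_image₂]
  refine ⟨a, mem_finsuppAntidiag_univ.2 (by omega), m₂, mem_finsuppAntidiag_univ.2 h₂, rfl⟩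

theorem M_le_pow_div_factorial {a b : ℕ} (h : b ≤ a) :
    (M a b : ℝ) ≤ (2 * (a : ℝ)) ^ b / (b.factorial : ℝ) := by
  refine (Nat.choose_le_pow_div (α := ℝ) b (a + b - 1)).trans ?_
  gcongr
  have : a + b - 1 ≤ 2 * a := by omega
  exact_mod_cast this

theorem div_pow_le_M {n k : ℕ} (hk : 1 ≤ k) : ((n : ℝ) / k) ^ k ≤ M n k := by
  refine le_trans ?_ (Nat.pow_le_choose (α := ℝ) k (n + k - 1))
  rw [show n + k - 1 + 1 - k = n by omega, div_pow]
  gcongr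
  exact_mod_cast Nat.factorial_le_pow k

theorem M_mul_M_le {n k d n0 k₀ l₀ : ℕ} {γ : ℝ} (hk : 1 ≤ k) (hkd : k < d) (hdn : d ≤ n)
    (hd : d ≤ n0) (hkl : k₀ + l₀ ≤ d)
    (hn0 : (n0 : ℝ) ≤ 2 * ((d : ℝ) - k) * ((n : ℝ) / k) ^ ((k : ℝ) / ((d : ℝ) - k)))
    (hγ : (k₀ : ℝ) + l₀ * ((k : ℝ) / ((d : ℝ) - k)) ≤ k - γ) :
    (M n0 l₀ * M n k₀ : ℝ) ≤ 16 ^ d * ((n : ℝ) / k) ^ ((k : ℝ) - γ) := by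
  have hk0 : (0 : ℝ) < k := by exact_mod_cast hk
  have hdk : (0 : ℝ) < (d : ℝ) - k := by
    rw [sub_pos]; exact_mod_cast hkd
  have hx : 1 ≤ (n : ℝ) / k := by
    rw [one_le_div hk0]; exact_mod_cast (by omega : k ≤ n)
  set x : ℝ := (n : ℝ) / k with hxdef
  have hx0 : 0 < x := by linarith
  have hnx : (n : ℝ) = k * x := by rw [hxdef]; field_simp
  set y : ℝ := x ^ ((k : ℝ) / ((d : ℝ) - k)) with hy
  have hy0 : 0 < y := Real.rpow_pos_of_pos hx0 _
  have h1 : (M n k₀ : ℝ) ≤ 4 ^ k₀ * x ^ k₀ * Real.exp k := by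
    calc (M n k₀ : ℝ) ≤ (2 * (n : ℝ)) ^ k₀ / (k₀.factorial : ℝ) :=
          M_le_pow_div_factorial (by omega)
      _ = 2 ^ k₀ * x ^ k₀ * ((k : ℝ) ^ k₀ / (k₀.factorial : ℝ)) := by
          rw [hnx, mul_pow, mul_pow]; ring
      _ ≤ 4 ^ k₀ * x ^ k₀ * Real.exp k := by
          gcongr
          · norm_num
          · exact Real.pow_div_factorial_le_exp _ hk0.le _
  have h2 : (M n0 l₀ : ℝ) ≤ 4 ^ l₀ * y ^ l₀ * Real.exp ((d : ℝ) - k) := by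
    calc (M n0 l₀ : ℝ) ≤ (2 * (n0 : ℝ)) ^ l₀ / (l₀.factorial : ℝ) :=
          M_le_pow_div_factorial (by omega)
      _ ≤ (2 * (2 * ((d : ℝ) - k) * y)) ^ l₀ / (l₀.factorial : ℝ) := by gcongr
      _ = 4 ^ l₀ * y ^ l₀ * (((d : ℝ) - k) ^ l₀ / (l₀.factorial : ℝ)) := by
          rw [show 2 * (2 * ((d : ℝ) - k) * y) = 4 * y * ((d : ℝ) - k) by ring, mul_pow, mul_pow]
          ring
      _ ≤ _ := by
          gcongr
          exact Real.pow_div_factorial_le_exp _ hdk.le _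
  have hexp : Real.exp ((d : ℝ) - k) * Real.exp k ≤ 4 ^ d := by
    rw [← Real.exp_add, sub_add_cancel, ← mul_one (d : ℝ), Real.exp_nat_mul]
    gcongr
    linarith [Real.exp_one_lt_d9]
  have hxy : y ^ l₀ * x ^ k₀ ≤ x ^ ((k : ℝ) - γ) := by
    rw [hy, ← Real.rpow_natCast, ← Real.rpow_natCast x, ← Real.rpow_mul hx0.le,
      ← Real.rpow_add hx0]
    exact Real.rpow_le_rpow_of_exponent_le hx (by linarith)
  have h4 : (4 : ℝ) ^ l₀ * 4 ^ k₀ ≤ 4 ^ d := by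
    rw [← pow_add]
    exact pow_le_pow_right₀ (by norm_num) (by omega)
  calc (M n0 l₀ * M n k₀ : ℝ)
      ≤ (4 ^ l₀ * y ^ l₀ * Real.exp ((d : ℝ) - k)) * (4 ^ k₀ * x ^ k₀ * Real.exp k) := by
        gcongr
    _ = (4 ^ l₀ * 4 ^ k₀) * (Real.exp ((d : ℝ) - k) * Real.exp k) * (y ^ l₀ * x ^ k₀) := by ring
    _ ≤ 4 ^ d * 4 ^ d * x ^ ((k : ℝ) - γ) := by gcongr
    _ = 16 ^ d * x ^ ((k : ℝ) - γ) := by rw [← mul_pow]; norm_num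

theorem two_mul_residue_le {t : ℕ} (k : ℕ) (ds : Fin t → ℕ) (κ : Fin t → ℕ) :
    2 * residue k ds ≤
      ∑ i, |(κ i : ℝ) - ((k : ℝ) / ((∑ i, ds i : ℕ) : ℝ)) * (ds i : ℝ)| := by
  rw [residue, ← mul_assoc, show (2 : ℝ) * (1 / 2) = 1 by norm_num, one_mul]
  refine csInf_le ⟨0, ?_⟩ ⟨fun i => (κ i : ℤ), by simp⟩
  rintro r ⟨κ', rfl⟩
  positivity

theorem add_mul_le_sub_residue {t k d : ℕ} {dq κ : Fin t → ℕ} (hd : ∑ i, dq i = d) (hkd : k < d)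
    (hκ : ∀ i, κ i ≤ dq i) (hk : ∑ i, κ i = k) (S : Finset (Fin t))
    (hS : ∀ i, i ∈ S ↔ k * dq i < κ i * d) :
    ((∑ i ∈ Sᶜ, κ i : ℕ) : ℝ) + (∑ i ∈ S, (dq i - κ i) : ℕ) * ((k : ℝ) / ((d : ℝ) - k))
      ≤ k - residue k dq := by
  have hd0 : (0 : ℝ) < d := by exact_mod_cast (by omega : 0 < d)
  have hdk : (0 : ℝ) < (d : ℝ) - k := by
    rw [sub_pos]; exact_mod_cast hkd
  set δ : Fin t → ℝ := fun i => (κ i : ℝ) - (k : ℝ) / d * dq i with hδ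
  have hres : 2 * residue k dq ≤ ∑ i, |δ i| := by
    have := two_mul_residue_le k dq κ
    rwa [hd] at this
  have hsplit : ∑ i, |δ i| = ∑ i ∈ S, δ i - ∑ i ∈ Sᶜ, δ i := by
    rw [← Finset.sum_add_sum_compl S, sub_eq_add_neg, ← Finset.sum_neg_distrib]
    congr 1
    · refine Finset.sum_congr rfl fun i hi => abs_of_nonneg ?_
      have : (k * dq i : ℝ) < κ i * d := by exact_mod_cast (hS i).1 hi
      rw [hδ]
      simp only
      rw [sub_nonneg, div_mul_eq_mul_div, div_le_iff₀ hd0]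
      exact this.le
    · refine Finset.sum_congr rfl fun i hi => abs_of_nonpos ?_
      have : (κ i * d : ℝ) ≤ k * dq i := by
        exact_mod_cast not_lt.1 fun h => Finset.mem_compl.1 hi ((hS i).2 h)
      rw [hδ]
      simp only
      rw [sub_nonpos, div_mul_eq_mul_div, le_div_iff₀ hd0]
      exact this
  have hdS : (∑ i ∈ S, (dq i : ℝ)) + ∑ i ∈ Sᶜ, (dq i : ℝ) = d := by
    rw [Finset.sum_add_sum_compl]; exact_mod_cast hd
  have hkS : (∑ i ∈ S, (κ i : ℝ)) + ∑ i ∈ Sᶜ, (κ i : ℝ) = k := by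
    rw [Finset.sum_add_sum_compl]; exact_mod_cast hk
  have hl : ((∑ i ∈ S, (dq i - κ i) : ℕ) : ℝ) = ∑ i ∈ S, (dq i : ℝ) - ∑ i ∈ S, (κ i : ℝ) := by
    rw [← Finset.sum_sub_distrib, Nat.cast_sum]
    exact Finset.sum_congr rfl fun i _ => Nat.cast_sub (hκ i)
  have h1 : ∑ i ∈ S, δ i = ∑ i ∈ S, (κ i : ℝ) - (k : ℝ) / d * ∑ i ∈ S, (dq i : ℝ) := by
    rw [hδ, Finset.sum_sub_distrib, Finset.mul_sum]
  have h2 : ∑ i ∈ Sᶜ, δ i = ∑ i ∈ Sᶜ, (κ i : ℝ) - (k : ℝ) / d * ∑ i ∈ Sᶜ, (dq i : ℝ) := by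
    rw [hδ, Finset.sum_sub_distrib, Finset.mul_sum]
  have hA0 : 0 ≤ ∑ i, |δ i| := by positivity
  rw [hl, Nat.cast_sum]
  generalize (∑ i ∈ S, (κ i : ℝ)) = a at *
  generalize (∑ i ∈ Sᶜ, (κ i : ℝ)) = b at *
  generalize (∑ i ∈ S, (dq i : ℝ)) = u at *
  generalize (∑ i ∈ Sᶜ, (dq i : ℝ)) = v at *
  generalize (∑ i ∈ S, δ i) = A at *
  generalize (∑ i ∈ Sᶜ, δ i) = B at *
  have hkd' : (k : ℝ) / d * d = k := by field_simp
  have hAB : B = -A := by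
    have : A + B = (a + b) - (k : ℝ) / d * (u + v) := by rw [h1, h2]; ring
    rw [hdS, hkS, hkd', sub_self] at this
    linarith
  have hA : residue k dq ≤ A ∧ 0 ≤ A := by
    constructor <;> linarith
  have key : b + (u - a) * ((k : ℝ) / (d - k)) = k - A - A * ((k : ℝ) / (d - k)) := by
    have hb : b = -A + (k : ℝ) / d * (d - u) := by rw [← hAB, h2, ← hdS]; ring
    have ha : a = A + (k : ℝ) / d * u := by rw [h1]; ring
    rw [hb, ha]
    field_simp
    ring
  rw [key]
  have : 0 ≤ A * ((k : ℝ) / (d - k)) := by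
    have := hA.2
    positivity
  linarith [hA.1]

theorem finrank_span_le_of_subset_span {F V ι : Type*} [Field F] [AddCommGroup V] [Module F V]
    [DecidableEq V] {X : Set V} (I : Finset ι) (T : ι → Finset V)
    (h : X ⊆ Submodule.span F (I.biUnion T : Set V)) :
    Module.finrank F (Submodule.span F X) ≤ ∑ i ∈ I, (T i).card := by
  have : Module.Finite F (Submodule.span F ((I.biUnion T : Finset V) : Set V)) :=
    FiniteDimensional.span_finset F _
  exact (Submodule.finrank_mono (Submodule.span_le.2 h)).trans
    ((finrank_span_finset_le_card _).trans Finset.card_biUnion_le)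

/-- Only the summands of degree `d` contribute to a homogeneous polynomial of degree `d`. -/
theorem eq_sum_filter_of_isHomogeneous {σ F ι : Type*} [Field F] [Fintype ι] {d : ℕ}
    {P : MvPolynomial σ F} (hP : P.IsHomogeneous d) {G : ι → MvPolynomial σ F} {e : ι → ℕ}
    (hG : ∀ i, (G i).IsHomogeneous (e i)) (h : P = ∑ i, G i) :
    P = ∑ i with e i = d, G i := by
  rw [← homogeneousComponent_eq_self hP, h, map_sum, Finset.sum_filter]
  refine Finset.sum_congr rfl fun i _ => ?_
  rw [homogeneousComponent_of_mem (hG i)]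
  simp only [eq_comm]

theorem card_piFinset_range_le {t : ℕ} (dq : Fin t → ℕ) :
    (Fintype.piFinset fun i => Finset.range (dq i + 1)).card ≤ 2 ^ ∑ i, dq i := by
  rw [Fintype.card_piFinset, ← Finset.prod_pow_eq_pow_sum]
  refine Finset.prod_le_prod' fun i _ => ?_
  rw [Finset.card_range]
  exact Nat.lt_two_pow_self

theorem exists_finset_of_residue {F : Type*} [Field F] {n n0 d k t : ℕ} {γ : ℝ}
    {Q : Fin t → MvPolynomial (Fin n) F} {dq : Fin t → ℕ} (hQ : ∀ j, (Q j).IsHomogeneous (dq j))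
    (hsum : ∑ j, dq j = d) (hk : 1 ≤ k) (hkd : k < d) (hdn : d ≤ n) (hd : d ≤ n0)
    (hn0 : (n0 : ℝ) ≤ 2 * ((d : ℝ) - k) * ((n : ℝ) / k) ^ ((k : ℝ) / ((d : ℝ) - k)))
    (hγ : γ ≤ residue k dq)
    {L : Fin n → MvPolynomial (Fin n0) F} (hL : ∀ i, (L i).IsHomogeneous 1) :
    ∃ T : Finset (MvPolynomial (Fin n0) F),
      (T.card : ℝ) ≤ 32 ^ d * ((n : ℝ) / k) ^ ((k : ℝ) - γ) ∧
      ∀ m : Fin n →₀ ℕ, m.degree = k →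
        aeval L (iterDeriv m (∏ j, Q j)) ∈ Submodule.span F (T : Set (MvPolynomial (Fin n0) F)) := by
  obtain ⟨T, hT, hspan⟩ := exists_finset_aeval_iterDeriv_prod_mem_span hQ hL k
    fun κ => {i | k * dq i < κ i * d}
  refine ⟨T, ?_, hspan⟩
  have hB : 0 ≤ 16 ^ d * ((n : ℝ) / k) ^ ((k : ℝ) - γ) := by positivity
  calc (T.card : ℝ) ≤ _ := Nat.cast_le.2 hT
    _ ≤ ∑ κ ∈ (Fintype.piFinset fun i => Finset.range (dq i + 1)) with ∑ i, κ i = k,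
        16 ^ d * ((n : ℝ) / k) ^ ((k : ℝ) - γ) := by
      rw [Nat.cast_sum]
      refine Finset.sum_le_sum fun κ hκ => ?_
      rw [Finset.mem_filter, Fintype.mem_piFinset] at hκ
      have hle : ∀ i, κ i ≤ dq i := fun i => Nat.lt_succ_iff.1 (Finset.mem_range.1 (hκ.1 i))
      rw [Nat.cast_mul]
      refine M_mul_M_le hk hkd hdn hd ?_ hn0 ?_
      · refine le_of_le_of_eq ?_
          ((Finset.sum_compl_add_sum {i | k * dq i < κ i * d} dq).trans hsum)
        exact add_le_add (Finset.sum_le_sum fun i _ => hle i)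
          (Finset.sum_le_sum fun i _ => Nat.sub_le _ _)
      · refine (add_mul_le_sub_residue hsum hkd hle hκ.2 _ fun i => by simp).trans ?_
        linarith
    _ ≤ 2 ^ d * (16 ^ d * ((n : ℝ) / k) ^ ((k : ℝ) - γ)) := by
      rw [Finset.sum_const, nsmul_eq_mul]
      refine mul_le_mul_of_nonneg_right ?_ hB
      have := (Finset.card_filter_le _ fun κ : Fin t → ℕ => ∑ i, κ i = k).trans
        (card_piFinset_range_le dq)
      rw [hsum] at this
      exact_mod_cast this
    _ = 32 ^ d * ((n : ℝ) / k) ^ ((k : ℝ) - γ) := by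
      rw [← mul_assoc, ← mul_pow]; norm_num


/-- high residue implies lower bounds, via affine projections of partials. -/
theorem stmt8 : ∃ c2 : ℝ, 0 < c2 ∧ ∃ c3 : ℝ, 0 < c3 ∧ ∀ c1 : ℝ, 0 ≤ c1 →
    ∀ (F : Type*) [Field F], ∀ (n d s : ℕ) (t : Fin s → ℕ)
      (Q : ∀ i : Fin s, Fin (t i) → MvPolynomial (Fin n) F)
      (dq : ∀ i : Fin s, Fin (t i) → ℕ),
      (∀ i j, (Q i j).IsHomogeneous (dq i j)) → (∀ i j, 1 ≤ dq i j) →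
      (∀ i j, Q i j ≠ 0) →
      ∀ P : MvPolynomial (Fin n) F, P = ∑ i, ∏ j, Q i j →
      P.IsHomogeneous d → 1 ≤ d →
      ∀ k : ℕ, 1 ≤ k → 2 * k < d →
      ∀ n0 : ℕ, d ≤ n0 → n0 ≤ n →
        ((d : ℝ) - (k : ℝ)) * ((n : ℝ) / (k : ℝ)) ^ ((k : ℝ) / ((d : ℝ) - (k : ℝ))) ≤ (n0 : ℝ) →
        (n0 : ℝ) ≤ 2 * ((d : ℝ) - (k : ℝ)) * ((n : ℝ) / (k : ℝ)) ^ ((k : ℝ) / ((d : ℝ) - (k : ℝ))) →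
      (2 : ℝ) ^ (-(c1 * (d : ℝ))) * (M n k : ℝ) ≤ (APP k n0 P : ℝ) →
      ∀ γ : ℝ, 0 < γ → (∀ i : Fin s, γ ≤ residue k (dq i)) →
      (2 : ℝ) ^ (-((c1 + c2) * (d : ℝ))) * ((n : ℝ) / (d : ℝ)) ^ (c3 * γ) ≤ (s : ℝ) := by
  refine ⟨5, by norm_num, 1, one_pos, ?_⟩
  intro c1 _ F _ n d s t Q dq hQ _ _ P hP hPd hd1 k hk h2k n0 hd hn _ hn0 hAPP γ hγ hres
  have hkd : k < d := by omega
  have hdn : d ≤ n := hd.trans hn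
  have hPsum := eq_sum_filter_of_isHomogeneous hPd
    (fun i => IsHomogeneous.prod Finset.univ (Q i) (dq i) fun j _ => hQ i j) hP
  set x : ℝ := (n : ℝ) / k with hx
  set B : ℝ := 32 ^ d * x ^ ((k : ℝ) - γ) with hB
  have hk0 : (0 : ℝ) < k := by exact_mod_cast hk
  have hn0' : (0 : ℝ) < n := by exact_mod_cast (by omega : 0 < n)
  have hx0 : 0 < x := by positivity
  have hB0 : 0 ≤ B := by positivity
  have hle : (APP k n0 P : ℝ) ≤ s * B := by
    rw [← Nat.le_floor_iff (by positivity)]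
    refine csSup_le' ?_
    rintro r ⟨L, hL, rfl⟩
    rw [Nat.le_floor_iff (by positivity)]
    classical
    have hT : ∀ i, ∃ T : Finset (MvPolynomial (Fin n0) F), (T.card : ℝ) ≤ B ∧
        (∑ j, dq i j = d → ∀ m : Fin n →₀ ℕ, m.degree = k →
          aeval L (iterDeriv m (∏ j, Q i j)) ∈
            Submodule.span F (T : Set (MvPolynomial (Fin n0) F))) := by
      intro i
      by_cases hi : ∑ j, dq i j = d
      · obtain ⟨T, h1, h2⟩ :=
          exists_finset_of_residue (hQ i) hi hk hkd hdn hd hn0 (hres i) hL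
        exact ⟨T, h1, fun _ => h2⟩
      · exact ⟨∅, by simpa using hB0, fun h => absurd h hi⟩
    choose T hTc hTs using hT
    have hfin := finrank_span_le_of_subset_span (F := F)
      (X := (fun g => aeval L g) '' partialsSet k P) Finset.univ T (by
        rintro _ ⟨_, ⟨m, hm, rfl⟩, rfl⟩
        simp only
        rw [hPsum, map_sum, map_sum]
        refine Submodule.sum_mem _ fun i hi => ?_
        refine Submodule.span_mono ?_ (hTs i (Finset.mem_filter.1 hi).2 m hm)
        exact Finset.coe_subset.2 (Finset.subset_biUnion_of_mem T (Finset.mem_univ i)))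
    calc ((Module.finrank F _ : ℕ) : ℝ) ≤ ((∑ i, (T i).card : ℕ) : ℝ) := Nat.cast_le.2 hfin
      _ ≤ ∑ _i : Fin s, B := by
        rw [Nat.cast_sum]
        exact Finset.sum_le_sum fun i _ => hTc i
      _ = s * B := by simp
  have hmain : (2 : ℝ) ^ (-(c1 * d)) * x ^ (k : ℝ) ≤ s * B := by
    refine le_trans ?_ (hAPP.trans hle)
    rw [Real.rpow_natCast]
    gcongr
    exact div_pow_le_M hk
  have hγx : ((n : ℝ) / d) ^ (1 * γ) ≤ x ^ γ := by
    rw [one_mul, hx]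
    gcongr
  have h32 : (32 : ℝ) ^ d = 2 ^ (5 * (d : ℝ)) := by
    rw [Real.rpow_mul (by norm_num), Real.rpow_natCast]
    norm_num
  have hxx : x ^ (k : ℝ) = x ^ ((k : ℝ) - γ) * x ^ γ := by
    rw [← Real.rpow_add hx0, sub_add_cancel]
  have hp : 0 < x ^ ((k : ℝ) - γ) := Real.rpow_pos_of_pos hx0 _
  have h2 : (2 : ℝ) ^ (-(c1 * d)) = 2 ^ (-((c1 + 5) * d)) * 32 ^ d := by
    rw [h32, ← Real.rpow_add (by norm_num)]
    congr 1
    ring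
  rw [hB, hxx, h2] at hmain
  have h3 : (2 : ℝ) ^ (-((c1 + 5) * (d : ℝ))) * x ^ γ ≤ s := by
    refine le_of_mul_le_mul_right ?_ (mul_pos (by positivity : (0 : ℝ) < 32 ^ d) hp)
    calc _ = _ := by ring
      _ ≤ _ := hmain
  refine le_trans ?_ h3
  gcongr
end
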